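/- Let Q be a finite quiver without loops and let M, N be two finite-dimensional P(Q)-modules. Then (dim M, dim N) = dim Hom(M,N) + dim Hom(N,M) − dim Ext¹(M,N). In particular dim Ext¹(M,N) = dim Ext¹(N,M). -/

import Mathlib

open CategoryTheory Limits Pretriangulated

universe v u

namespace GreenSeqPaper



/-- A finite quiver without loops: finitely many vertices `V` and arrows `A`,
with source and target maps, and no arrow from a vertex to itself. -/
structure LooplessQuiver where
  V : Type
  A : Type
  [fintypeV : Fintype V]
  [decEqV : DecidableEq V]
  [fintypeA : Fintype A]
  src : A → V
  tgt : A → V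
  no_loops : ∀ a, src a ≠ tgt a

attribute [instance] LooplessQuiver.fintypeV LooplessQuiver.decEqV LooplessQuiver.fintypeA

namespace LooplessQuiver

variable (Q : LooplessQuiver)

/-- The arrows of the double quiver `Q̄`: an arrow `a : i ⟶ j` of `Q` (left) together
with a reversed arrow `a* : j ⟶ i` (right). -/
abbrev DArrow := Q.A ⊕ Q.A

/-- Source of an arrow of the double quiver. -/
def dsrc : Q.DArrow → Q.V
  | .inl a => Q.src a
  | .inr a => Q.tgt a

/-- Target of an arrow of the double quiver. -/
def dtgt : Q.DArrow → Q.V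
  | .inl a => Q.tgt a
  | .inr a => Q.src a

/-- Generators of the path algebra of the double quiver: one idempotent `e i` for each
vertex `i` and one generator `x a` for each arrow `a` of the double quiver. -/
abbrev Gen := Q.V ⊕ Q.DArrow

/-- The vertex idempotent `e i` in the free algebra. -/
noncomputable def e (i : Q.V) : FreeAlgebra ℂ Q.Gen := FreeAlgebra.ι ℂ (Sum.inl i)

/-- The arrow generator `x a` in the free algebra. -/
noncomputable def x (a : Q.DArrow) : FreeAlgebra ℂ Q.Gen := FreeAlgebra.ι ℂ (Sum.inr a)

/-- The relations presenting the preprojective algebra `P(Q) = ℂQ̄/(c)`: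
the path-algebra relations of the double quiver `Q̄` (orthogonal vertex idempotents
summing to `1`, compatibility of arrows with their endpoints), together with the
preprojective relation `c = Σ_{a ∈ Q₁} (a a* - a* a) = 0`. -/
inductive Rel : FreeAlgebra ℂ Q.Gen → FreeAlgebra ℂ Q.Gen → Prop
  | vertex_mul (i j : Q.V) : Rel (Q.e i * Q.e j) (if i = j then Q.e i else 0)
  | vertex_sum : Rel (∑ i : Q.V, Q.e i) 1
  | arrow_left (a : Q.DArrow) : Rel (Q.e (Q.dtgt a) * Q.x a) (Q.x a)
  | arrow_right (a : Q.DArrow) : Rel (Q.x a * Q.e (Q.dsrc a)) (Q.x a)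
  | preprojective :
      Rel (∑ a : Q.A, (Q.x (Sum.inl a) * Q.x (Sum.inr a) - Q.x (Sum.inr a) * Q.x (Sum.inl a))) 0

/-- The preprojective algebra `P(Q)` of the quiver `Q`. -/
abbrev Preproj := RingQuot Q.Rel

/-- The image of the vertex idempotent `e i` in `P(Q)`. -/
noncomputable def pe (i : Q.V) : Q.Preproj := RingQuot.mkAlgHom ℂ Q.Rel (Q.e i)

/-- The image of the arrow generator `x a` in `P(Q)`. -/
noncomputable def px (a : Q.DArrow) : Q.Preproj := RingQuot.mkAlgHom ℂ Q.Rel (Q.x a)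

/-- The symmetric bilinear form `(x, y) = 2 Σ_i x_i y_i - Σ_{a : i → j ∈ Q̄₁} x_i y_j`
on the root lattice `ℤQ₀` (the sum runs over the arrows of the double quiver). -/
def form (v w : Q.V → ℤ) : ℤ :=
  2 * ∑ i : Q.V, v i * w i -
    ∑ a : Q.A, (v (Q.src a) * w (Q.tgt a) + v (Q.tgt a) * w (Q.src a))

/-- `Q` is of Dynkin type, i.e. its underlying graph is a disjoint union of ADE Dynkin
diagrams; equivalently, the symmetric bilinear form of `Q` is positive definite. -/
def IsDynkin : Prop := ∀ v : Q.V → ℤ, v ≠ 0 → 0 < Q.form v v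

end LooplessQuiver

section Modules

open ModuleCat

variable (Q : LooplessQuiver)

-- the scoped instances `ModuleCat.moduleOfAlgebraModule` and
-- `ModuleCat.isScalarTower_of_algebra_moduleCat` give each `P(Q)`-module its
-- canonical `ℂ`-vector space structure
attribute [local instance] ModuleCat.moduleOfAlgebraModule
  ModuleCat.isScalarTower_of_algebra_moduleCat

/-- A `P(Q)`-module is finite-dimensional if it is so as a `ℂ`-vector space. -/
def LooplessQuiver.FinDim (M : ModuleCat.{0} Q.Preproj) : Prop := FiniteDimensional ℂ M

/-- A `P(Q)`-module is nilpotent if all sufficiently long products of arrows act by zero;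
equivalently, all its composition factors are the vertex simples `S₁, …, Sₙ`. -/
def LooplessQuiver.IsNilpotentMod (M : ModuleCat.{0} Q.Preproj) : Prop :=
  ∃ N : ℕ, ∀ l : List Q.DArrow, l.length = N → ∀ m : M, (l.map Q.px).prod • m = 0

/-- The dimension of the vector space `eᵢ M` attached to the vertex `i` by the
`P(Q)`-module `M` (viewed as a representation of the double quiver). -/
noncomputable def LooplessQuiver.dimAt (M : ModuleCat.{0} Q.Preproj) (i : Q.V) : ℕ :=
  Module.finrank ℂ (Submodule.span ℂ (Set.range fun m : M => Q.pe i • m))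

/-- The dimension vector of a `P(Q)`-module, as an element of the root lattice `ℤQ₀`. -/
noncomputable def LooplessQuiver.dimVec (M : ModuleCat.{0} Q.Preproj) : Q.V → ℤ :=
  fun i => (Q.dimAt M i : ℤ)

/-- A brick: a module `M` with `Hom(M, M) = ℂ`, i.e. `M` is nonzero and every
endomorphism of `M` is multiplication by a scalar. -/
def LooplessQuiver.IsBrick (M : ModuleCat.{0} Q.Preproj) : Prop :=
  (∃ m : M, m ≠ 0) ∧
    ∀ f : M ⟶ M, ∃ c : ℂ, ∀ m : M, f m = algebraMap ℂ Q.Preproj c • m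

/-- `Ext¹(M, N) = 0` for `P(Q)`-modules. -/
def LooplessQuiver.Ext1Vanishes (M N : ModuleCat.{0} Q.Preproj) : Prop :=
  Subsingleton (((Ext ℂ (ModuleCat.{0} Q.Preproj) 1).obj (Opposite.op M)).obj N)

/-- A module is rigid if `Ext¹(M, M) = 0`. -/
def LooplessQuiver.IsRigid (M : ModuleCat.{0} Q.Preproj) : Prop := Q.Ext1Vanishes M M

/-- `dim_ℂ Extⁿ(M, N)` for `P(Q)`-modules. -/
noncomputable def LooplessQuiver.extDim (n : ℕ) (M N : ModuleCat.{0} Q.Preproj) : ℕ :=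
  Module.finrank ℂ (((Ext ℂ (ModuleCat.{0} Q.Preproj) n).obj (Opposite.op M)).obj N)

/-- `dim_ℂ Hom(M, N)` for `P(Q)`-modules. -/
noncomputable def LooplessQuiver.homDim (M N : ModuleCat.{0} Q.Preproj) : ℕ :=
  Module.finrank ℂ (M ⟶ N)

end Modules


section ExtGroups

variable {R : Type} [Ring R] [Algebra ℂ R]

attribute [local instance] ModuleCat.moduleOfAlgebraModule
  ModuleCat.isScalarTower_of_algebra_moduleCat

/-- `Ext¹` is the quotient of the cocycles by the coboundaries of a projective resolution. -/
theorem nonempty_ext_one_equiv (M N : ModuleCat.{0} R) (P : ProjectiveResolution M) :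
    Nonempty ((((Ext ℂ (ModuleCat.{0} R) 1).obj (Opposite.op M)).obj N) ≃ₗ[ℂ]
      (LinearMap.ker (Linear.leftComp ℂ N (P.complex.d 2 1)) ⧸
        (LinearMap.range (Linear.leftComp ℂ N (P.complex.d 1 0))).submoduleOf
          (LinearMap.ker (Linear.leftComp ℂ N (P.complex.d 2 1))))) := by
  let e := (P.isoExt (R := ℂ) 1 N) ≪≫
    (ShortComplex.homologyMapIso ((P.complex.linearYonedaObj ℂ N).isoSc' 0 1 2 (by simp) (by simp)))
      ≪≫ ShortComplex.moduleCatHomologyIso _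
  refine ⟨e.toLinearEquiv.trans (Submodule.quotEquivOfEq _ _ ?_)⟩
  ext x
  exact ⟨fun ⟨y, hy⟩ => ⟨y, congrArg Subtype.val hy⟩, fun ⟨y, hy⟩ => ⟨y, Subtype.ext hy⟩⟩

end ExtGroups

section LinearAlgebra

open Module

variable {k : Type*} [Field k]

theorem finrank_map_add_finrank_inf_ker {X Y : Type*} [AddCommGroup X] [Module k X]
    [AddCommGroup Y] [Module k Y] (f : X →ₗ[k] Y) (p : Submodule k X) [FiniteDimensional k p] :
    finrank k (p.map f) + finrank k ↥(p ⊓ LinearMap.ker f) = finrank k p := by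
  rw [← LinearMap.finrank_range_add_finrank_ker (f.domRestrict p), LinearMap.range_domRestrict,
    LinearMap.ker_domRestrict, ← Submodule.map_comap_subtype, Submodule.finrank_map_subtype_eq]

theorem finrank_add_finrank_ker_flip {X Y : Type*} [AddCommGroup X] [Module k X]
    [AddCommGroup Y] [Module k Y] [FiniteDimensional k X] [FiniteDimensional k Y]
    (β : X →ₗ[k] Y →ₗ[k] k) :
    finrank k X + finrank k (LinearMap.ker β.flip) =
      finrank k Y + finrank k (LinearMap.ker β) := by
  have h : finrank k (LinearMap.range β.flip) = finrank k (LinearMap.range β) := by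
    have : β.flip = β.dualMap ∘ₗ (evalEquiv k Y).toLinearMap := by ext; rfl
    rw [this, LinearMap.range_comp_of_range_eq_top _ (LinearEquiv.range _)]
    exact LinearMap.finrank_range_dualMap_eq_finrank_range β
  have h₁ := LinearMap.finrank_range_add_finrank_ker β
  have h₂ := LinearMap.finrank_range_add_finrank_ker β.flip
  omega

theorem finrank_quotient_add_finrank {X Y : Type*} [AddCommGroup X] [Module k X]
    [AddCommGroup Y] [Module k Y] [FiniteDimensional k Y] (D : X →ₗ[k] Y)
    {Z B : Submodule k X} {H₀ H₁ : Submodule k Y} (hB : ∀ f ∈ Z, D f ∈ H₀ ↔ f ∈ B)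
    (hD : Z.map D ⊔ H₀ = H₁) :
    finrank k (Z ⧸ B.submoduleOf Z) + finrank k H₀ = finrank k H₁ := by
  have hker : B.submoduleOf Z = LinearMap.ker ((H₀.mkQ ∘ₗ D).domRestrict Z) := by
    ext f
    simpa [Submodule.submoduleOf] using (hB f f.2).symm
  have hrange : LinearMap.range ((H₀.mkQ ∘ₗ D).domRestrict Z) = H₁.map H₀.mkQ := by
    rw [LinearMap.range_domRestrict, Submodule.map_comp, ← hD, Submodule.map_sup]
    simp
  have h := finrank_map_add_finrank_inf_ker H₀.mkQ H₁
  rw [Submodule.ker_mkQ, inf_eq_right.mpr (hD ▸ le_sup_right)] at h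
  rw [hker, (LinearMap.quotKerEquivRange _).finrank_eq, hrange, h]

theorem eq_zero_of_trace_comp_eq_zero {M N : Type*} [AddCommGroup M] [Module k M]
    [AddCommGroup N] [Module k N] [FiniteDimensional k M] [FiniteDimensional k N] {χ : M →ₗ[k] N}
    (h : ∀ ψ : N →ₗ[k] M, LinearMap.trace k N (χ ∘ₗ ψ) = 0) : χ = 0 := by
  ext m
  refine (Module.forall_dual_apply_eq_zero_iff k (χ m)).1 fun l => ?_
  have : χ ∘ₗ l.smulRight m = l.smulRight (χ m) := by ext; simp
  simpa [this] using h (l.smulRight m)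

/-- Linear maps supported between the images of two idempotents. -/
def cornerEquiv {M N : Type*} [AddCommGroup M] [Module k M] [AddCommGroup N] [Module k N]
    {p : End k M} {q : End k N} (hp : p * p = p) (hq : q * q = q) (S : Submodule k (M →ₗ[k] N))
    (hS : ∀ φ, φ ∈ S ↔ q ∘ₗ φ = φ ∧ φ ∘ₗ p = φ) :
    S ≃ₗ[k] (LinearMap.range p →ₗ[k] LinearMap.range q) where
  toFun φ := q.rangeRestrict ∘ₗ φ.1 ∘ₗ (LinearMap.range p).subtype
  map_add' φ φ' := by ext; simp
  map_smul' c φ := by ext; simp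
  invFun ψ := ⟨(LinearMap.range q).subtype ∘ₗ ψ ∘ₗ p.rangeRestrict, by
    rw [hS]
    constructor
    · ext m
      obtain ⟨n, hn⟩ := (ψ (p.rangeRestrict m)).2
      simpa [← hn] using LinearMap.congr_fun hq n
    · ext m
      have : p.rangeRestrict (p m) = p.rangeRestrict m := Subtype.ext (LinearMap.congr_fun hp m)
      simp [this]⟩
  left_inv φ := by
    obtain ⟨h₁, h₂⟩ := (hS φ).1 φ.2
    ext m
    simpa using (congrArg q (LinearMap.congr_fun h₂ m)).trans (LinearMap.congr_fun h₁ m)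
  right_inv ψ := by
    ext ⟨_, m, rfl⟩
    have h₁ : p.rangeRestrict (p m) = p.rangeRestrict m := Subtype.ext (LinearMap.congr_fun hp m)
    have h₂ : ∀ y : LinearMap.range q, q y = y := by
      rintro ⟨_, n, rfl⟩
      exact LinearMap.congr_fun hq n
    change q (ψ (p.rangeRestrict (p m))) = (ψ (p.rangeRestrict m) : N)
    rw [h₁, h₂]

theorem exists_equivariant_lift {R : Type*} [Ring R] [Algebra k R] {U M P : Type*}
    [AddCommGroup U] [Module k U] [AddCommGroup M] [Module R M] [Module k M]
    [AddCommGroup P] [Module R P] [Module k P] [IsScalarTower k R P] [Module.Projective R P]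
    (ρ : R →ₐ[k] End k U) (p : U →ₗ[k] M) (hp : ∀ r u, p (ρ r u) = r • p u)
    (hsurj : Function.Surjective p) (π : P →ₗ[R] M) :
    ∃ h : P →ₗ[k] U, (∀ r x, h (r • x) = ρ r (h x)) ∧ ∀ x, p (h x) = π x := by
  let _ : Module R U := Module.compHom U ρ.toRingHom
  let p' : U →ₗ[R] M := { toFun := p, map_add' := p.map_add, map_smul' := hp }
  obtain ⟨h, hh⟩ := Module.projective_lifting_property p' π hsurj
  have hs : ∀ r x, h (r • x) = ρ r (h x) := h.map_smul
  refine ⟨{ toFun := h, map_add' := h.map_add, map_smul' := fun c x => ?_ }, hs,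
    LinearMap.congr_fun hh⟩
  rw [← algebraMap_smul R c x, hs, AlgHom.commutes]
  rfl

theorem exists_partial_section {X Y : Type*} [AddCommGroup X] [Module k X]
    [AddCommGroup Y] [Module k Y] (d : X →ₗ[k] Y) :
    ∃ t : Y →ₗ[k] X, ∀ x, d (t (d x)) = d x := by
  obtain ⟨g, hg⟩ := d.rangeRestrict.exists_rightInverse_of_surjective d.range_rangeRestrict
  obtain ⟨t, ht⟩ := LinearMap.exists_extend g
  refine ⟨t, fun x => ?_⟩
  have h₁ := LinearMap.congr_fun ht (d.rangeRestrict x)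
  have h₂ := congrArg Subtype.val (LinearMap.congr_fun hg (d.rangeRestrict x))
  simp at h₁ h₂
  rw [h₁, h₂]

theorem map_partial_section_smul {R M N P₀ P₁ : Type*} [Ring R] [AddCommGroup M] [Module R M]
    [AddCommGroup N] [Module R N] [AddCommGroup P₀] [Module R P₀] [AddCommGroup P₁] [Module R P₁]
    {t : P₀ → P₁} {d : P₁ →ₗ[R] P₀} {π : P₀ →ₗ[R] M} (ht : ∀ p, d (t (d p)) = d p)
    (hd : Function.Exact d π) {f : P₁ →ₗ[R] N} (hf : ∀ p, d p = 0 → f p = 0) (r : R) {x : P₀}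
    (hx : π x = 0) : f (t (r • x)) = r • f (t x) := by
  obtain ⟨p, rfl⟩ := (hd x).1 hx
  rw [← map_smul d, ← map_smul f, ← sub_eq_zero, ← map_sub]
  refine hf _ ?_
  rw [map_sub, ht, map_smul d, map_smul d, ht, sub_self]

end LinearAlgebra

namespace LooplessQuiver

open Module

variable (Q : LooplessQuiver)

theorem pe_mul_pe (i j : Q.V) : Q.pe i * Q.pe j = if i = j then Q.pe i else 0 := by
  have h := RingQuot.mkAlgHom_rel ℂ (Rel.vertex_mul (Q := Q) i j)
  rw [map_mul] at h
  rw [pe, pe, h]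
  split_ifs <;> simp

theorem sum_pe : ∑ i, Q.pe i = 1 := by
  simpa [pe] using RingQuot.mkAlgHom_rel ℂ (Rel.vertex_sum (Q := Q))

theorem pe_mul_px (a : Q.DArrow) : Q.pe (Q.dtgt a) * Q.px a = Q.px a := by
  simpa [pe, px] using RingQuot.mkAlgHom_rel ℂ (Rel.arrow_left a)

theorem px_mul_pe (a : Q.DArrow) : Q.px a * Q.pe (Q.dsrc a) = Q.px a := by
  simpa [pe, px] using RingQuot.mkAlgHom_rel ℂ (Rel.arrow_right a)

/-- The sign of an arrow of the double quiver. -/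
def sign : Q.DArrow → ℂ := Sum.elim 1 (-1)

theorem sign_swap (a : Q.DArrow) : Q.sign a.swap = -Q.sign a := by
  cases a <;> simp [sign]

theorem sign_ne_zero (a : Q.DArrow) : Q.sign a ≠ 0 := by
  cases a <;> simp [sign]

theorem dsrc_swap (a : Q.DArrow) : Q.dsrc a.swap = Q.dtgt a := by
  cases a <;> rfl

theorem dtgt_swap (a : Q.DArrow) : Q.dtgt a.swap = Q.dsrc a := by
  cases a <;> rfl

theorem sum_sign_smul_mul_swap {R : Type*} [Ring R] [Algebra ℂ R] (f : Q.DArrow → R) :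
    ∑ a, Q.sign a • (f a * f a.swap) =
      ∑ a : Q.A, (f (.inl a) * f (.inr a) - f (.inr a) * f (.inl a)) := by
  simp [sign, Fintype.sum_sum_type, sub_eq_add_neg, Finset.sum_add_distrib]

theorem sum_sign_px : ∑ a, Q.sign a • (Q.px a * Q.px a.swap) = 0 := by
  refine (Q.sum_sign_smul_mul_swap Q.px).trans ?_
  simpa [px] using RingQuot.mkAlgHom_rel ℂ (Rel.preprojective (Q := Q))

section Action

variable {M : Type*} [AddCommGroup M] [Module Q.Preproj M]

theorem pe_smul_pe_smul (i j : Q.V) (m : M) :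
    Q.pe i • Q.pe j • m = if i = j then Q.pe i • m else 0 := by
  rw [smul_smul, pe_mul_pe]
  split_ifs <;> simp

theorem sum_pe_smul (m : M) : ∑ i, Q.pe i • m = m := by
  rw [← Finset.sum_smul, sum_pe, one_smul]

theorem pe_smul_px_smul (i : Q.V) (a : Q.DArrow) (m : M) :
    Q.pe i • Q.px a • m = if i = Q.dtgt a then Q.px a • m else 0 := by
  rw [← Q.pe_mul_px a, mul_smul, pe_smul_pe_smul]
  split_ifs with h <;> simp [h]

theorem px_smul_pe_smul (i : Q.V) (a : Q.DArrow) (m : M) :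
    Q.px a • Q.pe i • m = if i = Q.dsrc a then Q.px a • m else 0 := by
  rw [← Q.px_mul_pe a, mul_smul, pe_smul_pe_smul]
  split_ifs with h₁ h₂ h₂
  · rw [mul_smul]
  · exact absurd h₁.symm h₂
  · exact absurd h₂.symm h₁
  · simp

variable [Module ℂ M] [IsScalarTower ℂ Q.Preproj M]

theorem sum_sign_px_smul (m : M) : ∑ a, Q.sign a • Q.px a • Q.px a.swap • m = 0 := by
  simp_rw [smul_smul (Q.px _), ← smul_assoc, ← Finset.sum_smul, sum_sign_px, zero_smul]

variable {N : Type*} [AddCommGroup N] [Module Q.Preproj N] [Module ℂ N]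
  [IsScalarTower ℂ Q.Preproj N]

theorem map_algHom_of_generators {U : Type*} [AddCommGroup U] [Module ℂ U]
    (ρ : Q.Preproj →ₐ[ℂ] End ℂ U) (f : U →ₗ[ℂ] N)
    (he : ∀ i u, f (ρ (Q.pe i) u) = Q.pe i • f u)
    (hx : ∀ a u, f (ρ (Q.px a) u) = Q.px a • f u) (r : Q.Preproj) (u : U) :
    f (ρ r u) = r • f u := by
  obtain ⟨r, rfl⟩ := RingQuot.mkAlgHom_surjective ℂ Q.Rel r
  induction r using FreeAlgebra.induction generalizing u with
  | grade0 c => simp [AlgHom.commutes]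
  | grade1 g => cases g with
    | inl i => exact he i u
    | inr a => exact hx a u
  | mul r r' h h' => simp [mul_smul, h, h']
  | add r r' h h' => simp [add_smul, h, h']

theorem map_smul_of_generators (f : M →ₗ[ℂ] N) (he : ∀ i m, f (Q.pe i • m) = Q.pe i • f m)
    (hx : ∀ a m, f (Q.px a • m) = Q.px a • f m) (r : Q.Preproj) (m : M) :
    f (r • m) = r • f m :=
  Q.map_algHom_of_generators (Algebra.lsmul ℂ ℂ M) f he hx r m

end Action

/-- The action of the preprojective algebra attached to operators satisfying its relations. -/
theorem exists_algHom {U : Type*} [AddCommGroup U] [Module ℂ U] (E : Q.V → End ℂ U)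
    (X : Q.DArrow → End ℂ U) (hE : ∀ i j, E i * E j = if i = j then E i else 0)
    (hsum : ∑ i, E i = 1) (hl : ∀ a, E (Q.dtgt a) * X a = X a)
    (hr : ∀ a, X a * E (Q.dsrc a) = X a) (hX : ∑ a, Q.sign a • (X a * X a.swap) = 0) :
    ∃ ρ : Q.Preproj →ₐ[ℂ] End ℂ U, (∀ i, ρ (Q.pe i) = E i) ∧ ∀ a, ρ (Q.px a) = X a := by
  refine ⟨RingQuot.liftAlgHom ℂ ⟨FreeAlgebra.lift ℂ (Sum.elim E X), ?_⟩, fun i => ?_, fun a => ?_⟩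
  · intro r r' h
    cases h with
    | vertex_mul i j => split_ifs with hij <;> simp [e, hE, hij]
    | vertex_sum => simp [e, hsum]
    | arrow_left a => simp [e, x, hl]
    | arrow_right a => simp [e, x, hr]
    | preprojective =>
      rw [sum_sign_smul_mul_swap] at hX
      simpa [x] using hX
  · simp [pe, e, RingQuot.liftAlgHom_mkAlgHom_apply]
  · simp [px, x, RingQuot.liftAlgHom_mkAlgHom_apply]

section Complex

variable (M N : Type*) [AddCommGroup M] [Module Q.Preproj M] [Module ℂ M]
  [AddCommGroup N] [Module Q.Preproj N] [Module ℂ N] [IsScalarTower ℂ Q.Preproj N]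

/-- Linear maps preserving the decomposition indexed by the vertices. -/
def vertexMaps : Submodule ℂ (M →ₗ[ℂ] N) where
  carrier := {ψ | ∀ i m, ψ (Q.pe i • m) = Q.pe i • ψ m}
  add_mem' h h' i m := by simp [h i m, h' i m]
  zero_mem' i m := by simp
  smul_mem' c ψ h i m := (congrArg (c • ·) (h i m)).trans (smul_comm _ _ _)

/-- Families of linear maps between the components at the endpoints of the arrows. -/
def arrowMaps : Submodule ℂ (Q.DArrow → M →ₗ[ℂ] N) where
  carrier := {φ | ∀ a m, Q.pe (Q.dtgt a) • φ a m = φ a m ∧ φ a (Q.pe (Q.dsrc a) • m) = φ a m}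
  add_mem' h h' a m := by simp [h a m, h' a m]
  zero_mem' a m := by simp
  smul_mem' c φ h a m :=
    ⟨(smul_comm _ _ _).trans (congrArg (c • ·) (h a m).1), congrArg (c • ·) (h a m).2⟩

variable {M N}

theorem pe_smul_arrowMap {φ : Q.DArrow → M →ₗ[ℂ] N} (hφ : φ ∈ Q.arrowMaps M N) (i : Q.V)
    (a : Q.DArrow) (m : M) : Q.pe i • φ a m = if i = Q.dtgt a then φ a m else 0 := by
  rw [← (hφ a m).1, pe_smul_pe_smul]
  split_ifs with h <;> simp [h]

theorem arrowMap_pe_smul {φ : Q.DArrow → M →ₗ[ℂ] N} (hφ : φ ∈ Q.arrowMaps M N) (i : Q.V)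
    (a : Q.DArrow) (m : M) : φ a (Q.pe i • m) = if i = Q.dsrc a then φ a m else 0 := by
  rw [← (hφ a _).2, pe_smul_pe_smul]
  split_ifs with h₁ h₂ h₂
  · rw [(hφ a m).2]
  · exact absurd h₁.symm h₂
  · exact absurd h₂.symm h₁
  · simp

variable (M N) [IsScalarTower ℂ Q.Preproj M]

/-- The commutators of a linear map with the arrows. -/
noncomputable def commutatorMap : (M →ₗ[ℂ] N) →ₗ[ℂ] (Q.DArrow → M →ₗ[ℂ] N) where
  toFun ψ a := Algebra.lsmul ℂ ℂ N (Q.px a) ∘ₗ ψ - ψ ∘ₗ Algebra.lsmul ℂ ℂ M (Q.px a)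
  map_add' ψ ψ' := by ext; simp; abel
  map_smul' c ψ := by ext; simp [smul_comm _ c, smul_sub]

/-- The linearization of the preprojective relation. -/
noncomputable def momentMap : (Q.DArrow → M →ₗ[ℂ] N) →ₗ[ℂ] (M →ₗ[ℂ] N) where
  toFun φ := ∑ a, Q.sign a • (Algebra.lsmul ℂ ℂ N (Q.px a) ∘ₗ φ a.swap +
    φ a ∘ₗ Algebra.lsmul ℂ ℂ M (Q.px a.swap))
  map_add' φ φ' := by
    rw [← Finset.sum_add_distrib]
    refine Finset.sum_congr rfl fun a _ => ?_
    ext; simp; abel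
  map_smul' c φ := by
    rw [Finset.smul_sum]
    refine Finset.sum_congr rfl fun a _ => ?_
    ext; simp [smul_comm _ c]

variable {M N}

theorem commutatorMap_apply (ψ : M →ₗ[ℂ] N) (a : Q.DArrow) (m : M) :
    Q.commutatorMap M N ψ a m = Q.px a • ψ m - ψ (Q.px a • m) := rfl

theorem momentMap_apply (φ : Q.DArrow → M →ₗ[ℂ] N) (m : M) :
    Q.momentMap M N φ m =
      ∑ a, Q.sign a • (Q.px a • φ a.swap m + φ a (Q.px a.swap • m)) := by
  simp [momentMap]

theorem commutatorMap_mem {ψ : M →ₗ[ℂ] N} (hψ : ψ ∈ Q.vertexMaps M N) :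
    Q.commutatorMap M N ψ ∈ Q.arrowMaps M N := by
  intro a m
  simp only [commutatorMap_apply, smul_sub, ← hψ _ _, pe_smul_px_smul, px_smul_pe_smul, if_true]
  rw [hψ, px_smul_pe_smul]
  simp

theorem momentMap_mem {φ : Q.DArrow → M →ₗ[ℂ] N} (hφ : φ ∈ Q.arrowMaps M N) :
    Q.momentMap M N φ ∈ Q.vertexMaps M N := by
  intro i m
  simp only [momentMap_apply, Finset.smul_sum, smul_comm (Q.pe i), smul_add]
  refine Finset.sum_congr rfl fun a _ => ?_
  simp only [pe_smul_px_smul, px_smul_pe_smul, Q.pe_smul_arrowMap hφ, Q.arrowMap_pe_smul hφ,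
    dsrc_swap]
  split_ifs <;> simp

theorem momentMap_commutatorMap (ψ : M →ₗ[ℂ] N) :
    Q.momentMap M N (Q.commutatorMap M N ψ) = 0 := by
  ext m
  simp only [momentMap_apply, commutatorMap_apply, smul_sub, sub_add_sub_cancel,
    Finset.sum_sub_distrib, sum_sign_px_smul, ← map_smul ψ (Q.sign _), ← map_sum]
  simp

end Complex

section Dimensions

variable (M N : Type*) [AddCommGroup M] [Module Q.Preproj M] [Module ℂ M]
  [IsScalarTower ℂ Q.Preproj M] [AddCommGroup N] [Module Q.Preproj N] [Module ℂ N]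
  [IsScalarTower ℂ Q.Preproj N]

/-- The action of a vertex idempotent. -/
noncomputable abbrev proj (i : Q.V) : End ℂ M := Algebra.lsmul ℂ ℂ M (Q.pe i)

theorem proj_mul_self (i : Q.V) : Q.proj M i * Q.proj M i = Q.proj M i := by
  rw [← map_mul, pe_mul_pe, if_pos rfl]

variable {M N} in
theorem proj_coe (i : Q.V) (y : LinearMap.range (Q.proj M i)) : Q.pe i • (y : M) = y := by
  obtain ⟨_, m, rfl⟩ := y
  exact LinearMap.congr_fun (Q.proj_mul_self M i) m

/-- A map preserving the vertex decomposition amounts to its components at the vertices. -/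
noncomputable def vertexMapsEquiv : Q.vertexMaps M N ≃ₗ[ℂ]
    ((i : Q.V) → LinearMap.range (Q.proj M i) →ₗ[ℂ] LinearMap.range (Q.proj N i)) where
  toFun ψ i := (Q.proj N i).rangeRestrict ∘ₗ ψ.1 ∘ₗ (LinearMap.range (Q.proj M i)).subtype
  map_add' ψ ψ' := by ext; simp
  map_smul' c ψ := by ext; simp [smul_comm _ c]
  invFun ψ := ⟨∑ i, (LinearMap.range (Q.proj N i)).subtype ∘ₗ ψ i ∘ₗ (Q.proj M i).rangeRestrict, by
    intro j m
    simp only [LinearMap.sum_apply, Finset.smul_sum, LinearMap.comp_apply, Submodule.subtype_apply]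
    refine Finset.sum_congr rfl fun i _ => ?_
    have h : (Q.proj M i).rangeRestrict (Q.pe j • m) =
        if i = j then (Q.proj M i).rangeRestrict m else 0 := by
      refine Subtype.ext ((Q.pe_smul_pe_smul i j m).trans ?_)
      split_ifs <;> rfl
    rw [h, ← Q.proj_coe i (ψ i ((Q.proj M i).rangeRestrict m)), pe_smul_pe_smul]
    by_cases hij : i = j
    · subst hij
      simp [proj_coe]
    · simp [hij, Ne.symm hij]⟩
  left_inv ψ := by
    ext m
    simp only [LinearMap.sum_apply, LinearMap.comp_apply, Submodule.subtype_apply]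
    conv_rhs => rw [← Q.sum_pe_smul (ψ.1 m)]
    refine Finset.sum_congr rfl fun i _ => ?_
    change Q.pe i • ψ.1 (Q.pe i • m) = _
    rw [ψ.2, pe_smul_pe_smul, if_pos rfl]
  right_inv ψ := by
    ext i y
    change Q.pe i • (∑ j, (LinearMap.range (Q.proj N j)).subtype ∘ₗ ψ j ∘ₗ
      (Q.proj M j).rangeRestrict) (y : M) = (ψ i y : N)
    simp only [LinearMap.sum_apply, Finset.smul_sum, LinearMap.comp_apply, Submodule.subtype_apply]
    rw [Finset.sum_eq_single i]
    · have h : (Q.proj M i).rangeRestrict (y : M) = y := Subtype.ext (Q.proj_coe i y)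
      rw [h, proj_coe]
    · intro j _ hj
      rw [← Q.proj_coe j (ψ j _), pe_smul_pe_smul, if_neg (Ne.symm hj)]
    · simp

variable [FiniteDimensional ℂ M] [FiniteDimensional ℂ N]

theorem finrank_vertexMaps : finrank ℂ (Q.vertexMaps M N) =
    ∑ i, finrank ℂ (LinearMap.range (Q.proj M i)) * finrank ℂ (LinearMap.range (Q.proj N i)) := by
  rw [(Q.vertexMapsEquiv M N).finrank_eq, finrank_pi_fintype]
  simp_rw [finrank_linearMap]

/-- The component of `arrowMaps` at an arrow. -/
def cornerMaps (i j : Q.V) : Submodule ℂ (M →ₗ[ℂ] N) where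
  carrier := {φ | Q.proj N j ∘ₗ φ = φ ∧ φ ∘ₗ Q.proj M i = φ}
  add_mem' h h' := by
    simp only [Set.mem_ofPred_eq, LinearMap.comp_add, LinearMap.add_comp] at *
    rw [h.1, h.2, h'.1, h'.2]
    simp
  zero_mem' := by simp
  smul_mem' c φ h := by
    simp only [Set.mem_ofPred_eq, LinearMap.comp_smul, LinearMap.smul_comp] at *
    rw [h.1, h.2]
    simp

/-- A family in `arrowMaps` amounts to its components. -/
noncomputable def arrowMapsEquiv : Q.arrowMaps M N ≃ₗ[ℂ]
    ((a : Q.DArrow) → Q.cornerMaps M N (Q.dsrc a) (Q.dtgt a)) where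
  toFun φ a := ⟨φ.1 a, LinearMap.ext fun m => (φ.2 a m).1, LinearMap.ext fun m => (φ.2 a m).2⟩
  map_add' φ φ' := rfl
  map_smul' c φ := rfl
  invFun φ := ⟨fun a => φ a, fun a m =>
    ⟨LinearMap.congr_fun (φ a).2.1 m, LinearMap.congr_fun (φ a).2.2 m⟩⟩

theorem finrank_arrowMaps : finrank ℂ (Q.arrowMaps M N) =
    ∑ a, finrank ℂ (LinearMap.range (Q.proj M (Q.dsrc a))) *
      finrank ℂ (LinearMap.range (Q.proj N (Q.dtgt a))) := by
  rw [(Q.arrowMapsEquiv M N).finrank_eq, finrank_pi_fintype]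
  refine Finset.sum_congr rfl fun a _ => ?_
  rw [(cornerEquiv (Q.proj_mul_self M _) (Q.proj_mul_self N _) _ fun φ => Iff.rfl).finrank_eq,
    finrank_linearMap]

end Dimensions

section Duality

variable {M N : Type*} [AddCommGroup M] [Module Q.Preproj M] [Module ℂ M]
  [IsScalarTower ℂ Q.Preproj M] [AddCommGroup N] [Module Q.Preproj N] [Module ℂ N]
  [IsScalarTower ℂ Q.Preproj N] [FiniteDimensional ℂ N]

theorem trace_momentMap_comp (φ : Q.DArrow → M →ₗ[ℂ] N) (ψ : N →ₗ[ℂ] M) :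
    LinearMap.trace ℂ N (Q.momentMap M N φ ∘ₗ ψ) =
      ∑ a, Q.sign a • LinearMap.trace ℂ N (φ a ∘ₗ Q.commutatorMap N M ψ a.swap) := by
  have h₁ : Q.momentMap M N φ ∘ₗ ψ = ∑ a, Q.sign a • (Algebra.lsmul ℂ ℂ N (Q.px a) ∘ₗ φ a.swap ∘ₗ ψ
      + φ a ∘ₗ Algebra.lsmul ℂ ℂ M (Q.px a.swap) ∘ₗ ψ) := by
    ext n
    simp [momentMap_apply]
  have h₂ (a) : φ a ∘ₗ Q.commutatorMap N M ψ a.swap =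
      φ a ∘ₗ Algebra.lsmul ℂ ℂ M (Q.px a.swap) ∘ₗ ψ -
        φ a ∘ₗ ψ ∘ₗ Algebra.lsmul ℂ ℂ N (Q.px a.swap) := by
    ext n
    simp [commutatorMap_apply]
  have h₃ : ∑ a, Q.sign a • LinearMap.trace ℂ N (Algebra.lsmul ℂ ℂ N (Q.px a) ∘ₗ φ a.swap ∘ₗ ψ) =
      ∑ a, -(Q.sign a • LinearMap.trace ℂ N (φ a ∘ₗ ψ ∘ₗ Algebra.lsmul ℂ ℂ N (Q.px a.swap))) := by
    refine Fintype.sum_equiv (Equiv.sumComm _ _) _ _ fun a => ?_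
    simp only [Equiv.sumComm_apply, Sum.swap_swap, sign_swap, neg_smul, neg_neg]
    rw [LinearMap.trace_comp_cycle]
  simp only [h₁, h₂, map_sum, map_smul, map_add, map_sub, smul_add, smul_sub,
    Finset.sum_add_distrib, Finset.sum_sub_distrib, h₃, Finset.sum_neg_distrib]
  ring

variable [FiniteDimensional ℂ M]

theorem eq_zero_of_trace_comp_vertexMaps {χ : M →ₗ[ℂ] N} (hχ : χ ∈ Q.vertexMaps M N)
    (h : ∀ ψ ∈ Q.vertexMaps N M, LinearMap.trace ℂ N (χ ∘ₗ ψ) = 0) : χ = 0 := by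
  refine eq_zero_of_trace_comp_eq_zero fun ψ => ?_
  have hmem : ∑ i, Q.proj M i ∘ₗ ψ ∘ₗ Q.proj N i ∈ Q.vertexMaps N M := by
    intro j n
    simp only [LinearMap.sum_apply, Finset.smul_sum, LinearMap.comp_apply, Algebra.lsmul_coe,
      pe_smul_pe_smul]
    refine Finset.sum_congr rfl fun i _ => ?_
    by_cases hij : i = j
    · subst hij
      simp
    · simp [hij, Ne.symm hij]
  rw [← h _ hmem]
  have hχ' : ∀ i m, χ (Q.pe i • m) = Q.pe i • χ m := hχ
  have h₁ : χ ∘ₗ ∑ i, Q.proj M i ∘ₗ ψ ∘ₗ Q.proj N i =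
      ∑ i, (χ ∘ₗ Q.proj M i ∘ₗ ψ) ∘ₗ Q.proj N i := by
    ext; simp
  have h₂ : χ ∘ₗ ψ = ∑ i, Q.proj N i ∘ₗ χ ∘ₗ Q.proj M i ∘ₗ ψ := by
    ext n
    simp only [LinearMap.sum_apply, LinearMap.comp_apply, Algebra.lsmul_coe, hχ', pe_smul_pe_smul,
      if_true, sum_pe_smul]
  rw [h₁, h₂, map_sum, map_sum]
  exact Finset.sum_congr rfl fun i _ => LinearMap.trace_comp_comm' _ _

theorem eq_zero_of_trace_comp_arrowMaps {φ' : Q.DArrow → N →ₗ[ℂ] M} (hφ' : φ' ∈ Q.arrowMaps N M)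
    (h : ∀ φ ∈ Q.arrowMaps M N,
      ∑ a, Q.sign a • LinearMap.trace ℂ N (φ a ∘ₗ φ' a.swap) = 0) : φ' = 0 := by
  classical
  suffices ∀ a, φ' (Sum.swap a) = 0 from funext fun a => by simpa using this a.swap
  refine fun a => eq_zero_of_trace_comp_eq_zero fun φ => ?_
  have hmem : (Pi.single a (Q.proj N (Q.dtgt a) ∘ₗ φ ∘ₗ Q.proj M (Q.dsrc a))) ∈
      Q.arrowMaps M N := by
    intro b m
    obtain rfl | hb := eq_or_ne b a
    · simp [pe_smul_pe_smul]
    · simp [Pi.single_eq_of_ne hb]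
  have h' := h _ hmem
  rw [Finset.sum_eq_single a (fun b _ hb => by simp [Pi.single_eq_of_ne hb]) (by simp),
    Pi.single_eq_same, smul_eq_zero_iff_right (Q.sign_ne_zero a)] at h'
  rw [← h', LinearMap.trace_comp_comm' φ, LinearMap.comp_assoc,
    LinearMap.trace_comp_comm' _ (Q.proj N (Q.dtgt a)), LinearMap.comp_assoc, LinearMap.comp_assoc]
  congr 2
  ext n
  simp [Q.pe_smul_arrowMap hφ', Q.arrowMap_pe_smul hφ', dsrc_swap, dtgt_swap]

variable (M N) in
theorem finrank_arrowMaps_add_finrank_ker :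
    finrank ℂ (Q.arrowMaps M N) +
      finrank ℂ ↥(Q.vertexMaps N M ⊓ LinearMap.ker (Q.commutatorMap N M)) =
    finrank ℂ (Q.vertexMaps N M) +
      finrank ℂ ↥(Q.arrowMaps M N ⊓ LinearMap.ker (Q.momentMap M N)) := by
  let β : Q.arrowMaps M N →ₗ[ℂ] Q.vertexMaps N M →ₗ[ℂ] ℂ :=
    LinearMap.mk₂ ℂ (fun φ ψ => LinearMap.trace ℂ N (Q.momentMap M N φ ∘ₗ ψ.1))
      (by intros; simp [LinearMap.add_comp]) (by intros; simp [LinearMap.smul_comp])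
      (by intros; simp [LinearMap.comp_add]) (by intros; simp [LinearMap.comp_smul])
  have h₁ : LinearMap.ker β =
      (LinearMap.ker (Q.momentMap M N)).comap (Q.arrowMaps M N).subtype := by
    ext φ
    refine ⟨fun h => ?_, fun h => LinearMap.ext fun ψ => ?_⟩
    · exact Q.eq_zero_of_trace_comp_vertexMaps (Q.momentMap_mem φ.2)
        fun ψ hψ => LinearMap.congr_fun h ⟨ψ, hψ⟩
    · have : Q.momentMap M N φ = 0 := h
      simp [β, this]
  have h₂ : LinearMap.ker β.flip =
      (LinearMap.ker (Q.commutatorMap N M)).comap (Q.vertexMaps N M).subtype := by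
    ext ψ
    refine ⟨fun h => ?_, fun h => LinearMap.ext fun φ => ?_⟩
    · refine Q.eq_zero_of_trace_comp_arrowMaps (Q.commutatorMap_mem ψ.2) fun φ hφ => ?_
      rw [← Q.trace_momentMap_comp]
      exact LinearMap.congr_fun h ⟨φ, hφ⟩
    · have : Q.commutatorMap N M ψ = 0 := h
      simp [β, trace_momentMap_comp, this]
  rw [← Submodule.map_comap_subtype, ← Submodule.map_comap_subtype,
    Submodule.finrank_map_subtype_eq, Submodule.finrank_map_subtype_eq, ← h₁, ← h₂]
  exact finrank_add_finrank_ker_flip β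

end Duality

section Presentation

variable {M N P₀ P₁ : Type*} [AddCommGroup M] [Module Q.Preproj M] [Module ℂ M]
  [IsScalarTower ℂ Q.Preproj M] [AddCommGroup N] [Module Q.Preproj N] [Module ℂ N]
  [IsScalarTower ℂ Q.Preproj N] [AddCommGroup P₀] [Module Q.Preproj P₀] [Module ℂ P₀]
  [IsScalarTower ℂ Q.Preproj P₀] [AddCommGroup P₁] [Module Q.Preproj P₁] [Module ℂ P₁]
  [IsScalarTower ℂ Q.Preproj P₁]

variable (N) in
/-- The family of maps attached to a map out of the syzygies, by means of a section `s` of the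
presentation and a partial inverse `t` of the differential. -/
noncomputable def cocycleMap (s : M →ₗ[ℂ] P₀) (t : P₀ →ₗ[ℂ] P₁) :
    (P₁ →ₗ[Q.Preproj] N) →ₗ[ℂ] (Q.DArrow → M →ₗ[ℂ] N) where
  toFun f a := f.restrictScalars ℂ ∘ₗ t ∘ₗ Q.commutatorMap M P₀ s a
  map_add' _ _ := rfl
  map_smul' _ _ := rfl

theorem cocycleMap_apply (s : M →ₗ[ℂ] P₀) (t : P₀ →ₗ[ℂ] P₁) (f : P₁ →ₗ[Q.Preproj] N)
    (a : Q.DArrow) (m : M) :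
    Q.cocycleMap N s t f a m = f (t (Q.px a • s m - s (Q.px a • m))) := rfl

theorem exists_vertex_section {π : P₀ →ₗ[Q.Preproj] M} (hπ : Function.Surjective π) :
    ∃ s ∈ Q.vertexMaps M P₀, ∀ m, π (s m) = m := by
  obtain ⟨s, hs⟩ := (π.restrictScalars ℂ).exists_rightInverse_of_surjective
    (LinearMap.range_eq_top.2 hπ)
  have hs' : ∀ m, π (s m) = m := LinearMap.congr_fun hs
  refine ⟨∑ i, Q.proj P₀ i ∘ₗ s ∘ₗ Q.proj M i, fun j m => ?_, fun m => ?_⟩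
  · simp only [LinearMap.sum_apply, Finset.smul_sum, LinearMap.comp_apply, Algebra.lsmul_coe,
      pe_smul_pe_smul]
    refine Finset.sum_congr rfl fun i _ => ?_
    by_cases hij : i = j
    · subst hij
      simp
    · simp [hij, Ne.symm hij]
  · simp only [LinearMap.sum_apply, LinearMap.comp_apply, Algebra.lsmul_coe, map_sum, map_smul,
      hs', pe_smul_pe_smul, if_true, sum_pe_smul]

variable {s : M →ₗ[ℂ] P₀} {t : P₀ →ₗ[ℂ] P₁} {d : P₁ →ₗ[Q.Preproj] P₀} {π : P₀ →ₗ[Q.Preproj] M}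

theorem map_commutatorMap_section (hs : ∀ m, π (s m) = m) (a : Q.DArrow) (m : M) :
    π (Q.commutatorMap M P₀ s a m) = 0 := by
  simp [commutatorMap_apply, hs]

theorem cocycleMap_mem (hsv : s ∈ Q.vertexMaps M P₀) (hs : ∀ m, π (s m) = m)
    (ht : ∀ p, d (t (d p)) = d p) (hd : Function.Exact d π)
    {f : P₁ →ₗ[Q.Preproj] N} (hf : ∀ p, d p = 0 → f p = 0) :
    Q.cocycleMap N s t f ∈ Q.arrowMaps M N ⊓ LinearMap.ker (Q.momentMap M N) := by
  have hc := Q.commutatorMap_mem hsv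
  have hG := fun r a m => map_partial_section_smul ht hd hf r
    (Q.map_commutatorMap_section hs a m)
  refine ⟨fun a m => ⟨?_, ?_⟩, ?_⟩
  · exact (hG _ a m).symm.trans (congrArg (f <| t ·) (hc a m).1)
  · exact congrArg (f <| t ·) (hc a m).2
  · ext m
    have h := congrArg (f.restrictScalars ℂ <| t ·)
      (LinearMap.congr_fun (Q.momentMap_commutatorMap s) m)
    simp only [momentMap_apply, map_sum, map_smul, map_add, LinearMap.zero_apply, map_zero,
      LinearMap.restrictScalars_apply] at h
    rw [momentMap_apply, LinearMap.zero_apply, ← h]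
    exact Finset.sum_congr rfl fun a _ => by rw [hG]; rfl

theorem cocycleMap_mem_map_iff (hsv : s ∈ Q.vertexMaps M P₀) (hs : ∀ m, π (s m) = m)
    (ht : ∀ p, d (t (d p)) = d p) (hd : Function.Exact d π)
    {f : P₁ →ₗ[Q.Preproj] N} (hf : ∀ p, d p = 0 → f p = 0) :
    Q.cocycleMap N s t f ∈ (Q.vertexMaps M N).map (Q.commutatorMap M N) ↔
      ∃ g : P₀ →ₗ[Q.Preproj] N, g ∘ₗ d = f := by
  have hG := fun r x (hx : π x = 0) => map_partial_section_smul ht hd hf r hx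
  have hsec (p) : π (p - s (π p)) = 0 := by rw [map_sub, hs, sub_self]
  constructor
  · rintro ⟨ψ, hψ, h⟩
    have hψ' (a m) : Q.px a • ψ m - ψ (Q.px a • m) = f (t (Q.px a • s m - s (Q.px a • m))) :=
      LinearMap.congr_fun (congrFun h a) m
    let g : P₀ →ₗ[ℂ] N := (f.restrictScalars ℂ ∘ₗ t) ∘ₗ (LinearMap.id - s ∘ₗ π.restrictScalars ℂ) +
      ψ ∘ₗ π.restrictScalars ℂ
    have hg (p) : g p = f (t (p - s (π p))) + ψ (π p) := rfl
    have hglin : ∀ (r : Q.Preproj) p, g (r • p) = r • g p := by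
      refine Q.map_smul_of_generators g (fun i p => ?_) fun a p => ?_
      · rw [hg, hg, smul_add, ← hG _ _ (hsec p), smul_sub, ← hsv, ← hψ, map_smul]
      · have : Q.px a • p - s (Q.px a • π p) = Q.px a • (p - s (π p)) +
            (Q.px a • s (π p) - s (Q.px a • π p)) := by rw [smul_sub]; abel
        rw [hg, hg, smul_add, map_smul, this, map_add, map_add, hG _ _ (hsec p), ← hψ']
        abel
    refine ⟨{ g with map_smul' := hglin }, LinearMap.ext fun p => ?_⟩
    change g (d p) = f p
    rw [hg, hd.apply_apply_eq_zero, map_zero, sub_zero, map_zero, add_zero, ← sub_eq_zero,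
      ← map_sub]
    exact hf _ (by rw [map_sub, ht, sub_self])
  · rintro ⟨g, rfl⟩
    refine ⟨g.restrictScalars ℂ ∘ₗ s, fun i m => ?_, ?_⟩
    · simp [show s (Q.pe i • m) = _ from hsv i m]
    · ext a m
      obtain ⟨p, hp⟩ := (hd _).1 (Q.map_commutatorMap_section hs a m)
      rw [commutatorMap_apply] at hp
      rw [cocycleMap_apply, ← hp, LinearMap.comp_apply, ht, hp]
      simp [commutatorMap_apply]

theorem exists_extension_algHom {φ : Q.DArrow → M →ₗ[ℂ] N} (hφ : φ ∈ Q.arrowMaps M N)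
    (hφ' : Q.momentMap M N φ = 0) :
    ∃ ρ : Q.Preproj →ₐ[ℂ] End ℂ (N × M),
      (∀ i u, ρ (Q.pe i) u = (Q.pe i • u.1, Q.pe i • u.2)) ∧
      ∀ a u, ρ (Q.px a) u = (Q.px a • u.1 + φ a u.2, Q.px a • u.2) := by
  let E (i : Q.V) : End ℂ (N × M) := (Q.proj N i).prodMap (Q.proj M i)
  let X (a : Q.DArrow) : End ℂ (N × M) :=
    (Algebra.lsmul ℂ ℂ N (Q.px a)).prodMap (Algebra.lsmul ℂ ℂ M (Q.px a)) +
      LinearMap.inl ℂ N M ∘ₗ φ a ∘ₗ LinearMap.snd ℂ N M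
  have hE (i u) : E i u = (Q.pe i • u.1, Q.pe i • u.2) := rfl
  have hX (a u) : X a u = (Q.px a • u.1 + φ a u.2, Q.px a • u.2) := by simp [X]
  refine (Q.exists_algHom E X (fun i j => LinearMap.ext fun u => ?_)
    (LinearMap.ext fun u => ?_) (fun a => LinearMap.ext fun u => ?_)
    (fun a => LinearMap.ext fun u => ?_) (LinearMap.ext fun u => ?_)).imp fun ρ h =>
      ⟨fun i u => by rw [h.1, hE], fun a u => by rw [h.2, hX]⟩
  · rw [End.mul_apply, hE, hE, pe_smul_pe_smul, pe_smul_pe_smul]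
    split_ifs <;> rfl
  · simp only [LinearMap.sum_apply, hE, End.one_apply]
    ext <;> simp [Prod.fst_sum, Prod.snd_sum, sum_pe_smul]
  · rw [End.mul_apply, hE, hX]
    simp [smul_add, pe_smul_px_smul, Q.pe_smul_arrowMap hφ]
  · rw [End.mul_apply, hE, hX, hX]
    simp [px_smul_pe_smul, Q.arrowMap_pe_smul hφ]
  · have h := LinearMap.congr_fun hφ' u.2
    rw [momentMap_apply, LinearMap.zero_apply] at h
    simp only [LinearMap.sum_apply, LinearMap.smul_apply, End.mul_apply, hX, LinearMap.zero_apply]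
    ext
    · simp only [Prod.fst_sum, Prod.smul_fst, smul_add, add_assoc, Finset.sum_add_distrib,
        sum_sign_px_smul, zero_add, Prod.fst_zero] at h ⊢
      exact h
    · simp only [Prod.snd_sum, Prod.smul_snd, sum_sign_px_smul, Prod.snd_zero]

theorem exists_cocycleMap_add_commutatorMap [Module.Projective Q.Preproj P₀]
    (hsv : s ∈ Q.vertexMaps M P₀) (hs : ∀ m, π (s m) = m)
    (ht : ∀ p, d (t (d p)) = d p) (hd : Function.Exact d π) {φ : Q.DArrow → M →ₗ[ℂ] N}
    (hφ : φ ∈ Q.arrowMaps M N ⊓ LinearMap.ker (Q.momentMap M N)) :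
    ∃ f : P₁ →ₗ[Q.Preproj] N, (∀ p, d p = 0 → f p = 0) ∧ ∃ ψ ∈ Q.vertexMaps M N,
      Q.cocycleMap N s t f + Q.commutatorMap M N ψ = φ := by
  obtain ⟨ρ, hρe, hρx⟩ := Q.exists_extension_algHom hφ.1 hφ.2
  have hsnd := Q.map_algHom_of_generators ρ (LinearMap.snd ℂ N M)
    (fun i u => by simp [hρe]) fun a u => by simp [hρx]
  obtain ⟨h, hh, hhπ⟩ := exists_equivariant_lift ρ (LinearMap.snd ℂ N M) hsnd
    LinearMap.snd_surjective π
  have hhπ' (p) : (h p).2 = π p := hhπ p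
  let f₀ : P₁ →ₗ[ℂ] N := LinearMap.fst ℂ N M ∘ₗ h ∘ₗ d.restrictScalars ℂ
  have hf₀ : ∀ (r : Q.Preproj) p, f₀ (r • p) = r • f₀ p := by
    refine Q.map_smul_of_generators f₀ (fun i p => ?_) fun a p => ?_
    · simp [f₀, hh, hρe]
    · simp [f₀, hh, hρx, hhπ', hd.apply_apply_eq_zero]
  refine ⟨{ f₀ with map_smul' := hf₀ }, fun p hp => ?_, -(LinearMap.fst ℂ N M ∘ₗ h ∘ₗ s),
    fun i m => ?_, ?_⟩
  · change (h (d p)).1 = 0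
    rw [hp, map_zero, Prod.fst_zero]
  · have := hsv i m
    simp [this, hh, hρe]
  · ext a m
    obtain ⟨p, hp⟩ := (hd _).1 (Q.map_commutatorMap_section hs a m)
    rw [commutatorMap_apply] at hp
    have h₁ : Q.cocycleMap N s t { f₀ with map_smul' := hf₀ } a m = (h (d p)).1 := by
      rw [cocycleMap_apply, ← hp]
      exact congrArg (fun q => (h q).1) (ht p)
    rw [Pi.add_apply, LinearMap.add_apply, h₁, hp, commutatorMap_apply]
    simp [hh, hρx, hhπ', hs]

end Presentation

section ExtDimension

attribute [local instance] ModuleCat.moduleOfAlgebraModule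
  ModuleCat.isScalarTower_of_algebra_moduleCat

variable {Q} (M N : ModuleCat.{0} Q.Preproj)

theorem extDim_one_add_finrank [FiniteDimensional ℂ M] [FiniteDimensional ℂ N] :
    Q.extDim 1 M N + finrank ℂ ((Q.vertexMaps M N).map (Q.commutatorMap M N)) =
      finrank ℂ ↥(Q.arrowMaps M N ⊓ LinearMap.ker (Q.momentMap M N)) := by
  let P := projectiveResolution M
  obtain ⟨e⟩ := nonempty_ext_one_equiv M N P
  let π : P.complex.X 0 ⟶ M := P.π.f 0
  have hepi : Epi π := inferInstanceAs (Epi (P.π.f 0))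
  have hπ : Function.Surjective π.hom := (ModuleCat.epi_iff_surjective π).1 hepi
  have hd : Function.Exact (P.complex.d 1 0).hom π.hom :=
    (ShortComplex.ShortExact.moduleCat_exact_iff_function_exact _).1 P.exact₀
  have hd' : Function.Exact (P.complex.d 2 1).hom (P.complex.d 1 0).hom :=
    (ShortComplex.ShortExact.moduleCat_exact_iff_function_exact _).1 (P.exact_succ 0)
  have : Module.Projective Q.Preproj (P.complex.X 0) :=
    (IsProjective.iff_projective _).2 (P.projective 0)
  obtain ⟨s, hsv, hs⟩ := Q.exists_vertex_section hπ
  obtain ⟨t, ht⟩ := exists_partial_section ((P.complex.d 1 0).hom.restrictScalars ℂ)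
  have hZ (f : P.complex.X 1 ⟶ N) : f ∈ LinearMap.ker (Linear.leftComp ℂ N (P.complex.d 2 1)) ↔
      ∀ p, (P.complex.d 1 0).hom p = 0 → f.hom p = 0 := by
    rw [LinearMap.mem_ker, Linear.leftComp_apply]
    refine ⟨fun h p hp => ?_, fun h => ModuleCat.hom_ext (LinearMap.ext fun q => ?_)⟩
    · obtain ⟨q, rfl⟩ := (hd' p).1 hp
      exact LinearMap.congr_fun (congrArg ModuleCat.Hom.hom h) q
    · exact h _ (hd'.apply_apply_eq_zero q)
  let D := Q.cocycleMap N s t ∘ₗ (ModuleCat.homLinearEquiv (S := ℂ)).toLinearMap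
  rw [LooplessQuiver.extDim, e.finrank_eq]
  refine finrank_quotient_add_finrank D (fun f hf => ?_) (le_antisymm (sup_le ?_ ?_) ?_)
  · refine (Q.cocycleMap_mem_map_iff hsv hs ht hd ((hZ f).1 hf)).trans ⟨?_, ?_⟩
    · rintro ⟨g, hg⟩
      exact ⟨ModuleCat.ofHom g, ModuleCat.hom_ext hg⟩
    · rintro ⟨g, rfl⟩
      exact ⟨g.hom, rfl⟩
  · rintro _ ⟨f, hf, rfl⟩
    exact Q.cocycleMap_mem hsv hs ht hd ((hZ f).1 hf)
  · rintro _ ⟨ψ, hψ, rfl⟩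
    exact ⟨Q.commutatorMap_mem hψ, Q.momentMap_commutatorMap ψ⟩
  · intro φ hφ
    obtain ⟨f, hf, ψ, hψ, rfl⟩ := Q.exists_cocycleMap_add_commutatorMap hsv hs ht hd hφ
    exact Submodule.add_mem_sup ⟨ModuleCat.ofHom f, (hZ _).2 hf, rfl⟩ ⟨ψ, hψ, rfl⟩

theorem homDim_eq_finrank : Q.homDim M N =
    finrank ℂ ↥(Q.vertexMaps M N ⊓ LinearMap.ker (Q.commutatorMap M N)) := by
  let e : (M ⟶ N) ≃ₗ[ℂ] ↥(Q.vertexMaps M N ⊓ LinearMap.ker (Q.commutatorMap M N)) :=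
    { toFun := fun f => ⟨f.hom.restrictScalars ℂ, fun i m => f.hom.map_smul _ _, by
        ext a m
        simp [commutatorMap_apply]⟩
      map_add' := fun f g => rfl
      map_smul' := fun c f => rfl
      invFun := fun ψ => ModuleCat.ofHom
        { ψ.1 with
          map_smul' := Q.map_smul_of_generators ψ.1 ψ.2.1 fun a m =>
            (sub_eq_zero.1 (LinearMap.congr_fun (congrFun ψ.2.2 a) m)).symm } }
  exact e.finrank_eq

theorem dimAt_eq_finrank (i : Q.V) :
    Q.dimAt M i = finrank ℂ (LinearMap.range (Q.proj M i)) := by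
  have : (Set.range fun m : M => Q.pe i • m) = LinearMap.range (Q.proj M i) := rfl
  rw [dimAt, this, Submodule.span_eq]

theorem form_eq (hM : Q.FinDim M) (hN : Q.FinDim N) :
    Q.form (Q.dimVec M) (Q.dimVec N) =
      (Q.homDim M N : ℤ) + (Q.homDim N M : ℤ) - (Q.extDim 1 M N : ℤ) := by
  have : FiniteDimensional ℂ M := hM
  have : FiniteDimensional ℂ N := hN
  have h₁ := extDim_one_add_finrank M N
  have h₂ := finrank_map_add_finrank_inf_ker (Q.commutatorMap M N) (Q.vertexMaps M N)
  have h₃ := Q.finrank_arrowMaps_add_finrank_ker M N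
  rw [← homDim_eq_finrank] at h₂ h₃
  have hV (M N : ModuleCat.{0} Q.Preproj) [FiniteDimensional ℂ M] [FiniteDimensional ℂ N] :
      (finrank ℂ (Q.vertexMaps M N) : ℤ) = ∑ i, Q.dimVec M i * Q.dimVec N i := by
    rw [finrank_vertexMaps]
    simp only [dimVec, dimAt_eq_finrank, Nat.cast_sum, Nat.cast_mul]
  have hMN := hV M N
  have hNM := hV N M
  simp only [mul_comm (Q.dimVec N _)] at hNM
  have hA : (finrank ℂ (Q.arrowMaps M N) : ℤ) = ∑ a : Q.A, (Q.dimVec M (Q.src a) *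
      Q.dimVec N (Q.tgt a) + Q.dimVec M (Q.tgt a) * Q.dimVec N (Q.src a)) := by
    rw [finrank_arrowMaps, Fintype.sum_sum_type, Finset.sum_add_distrib]
    simp only [dimVec, dimAt_eq_finrank, dsrc, dtgt, Nat.cast_add, Nat.cast_sum, Nat.cast_mul]
    rfl
  rw [form, ← hA]
  generalize (∑ i, Q.dimVec M i * Q.dimVec N i) = S at hMN hNM ⊢
  generalize finrank ℂ ↥(Q.arrowMaps M N ⊓ LinearMap.ker (Q.momentMap M N)) = z at h₁ h₃
  generalize finrank ℂ (Q.arrowMaps M N) = a at h₃ ⊢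
  generalize finrank ℂ ((Q.vertexMaps M N).map (Q.commutatorMap M N)) = b at h₁ h₂
  generalize finrank ℂ (Q.vertexMaps M N) = c at h₂ hMN
  generalize finrank ℂ (Q.vertexMaps N M) = c' at h₃ hNM
  omega

theorem form_comm (v w : Q.V → ℤ) : Q.form v w = Q.form w v := by
  simp only [form, mul_comm (v _), add_comm (w (Q.tgt _) * _)]

end ExtDimension

end LooplessQuiver

/-- Crawley-Boevey. Let `Q` be a finite quiver without loops
and `M`, `N` two finite-dimensional `P(Q)`-modules.  Then
`(dim M, dim N) = dim Hom(M, N) + dim Hom(N, M) - dim Ext¹(M, N)`.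
In particular `dim Ext¹(M, N) = dim Ext¹(N, M)`. -/
theorem form_eq_hom_add_hom_sub_ext
    (Q : LooplessQuiver) (M N : ModuleCat.{0} Q.Preproj)
    (hM : Q.FinDim M) (hN : Q.FinDim N) :
    Q.form (Q.dimVec M) (Q.dimVec N)
        = (Q.homDim M N : ℤ) + (Q.homDim N M : ℤ) - (Q.extDim 1 M N : ℤ) ∧
      Q.extDim 1 M N = Q.extDim 1 N M := by
  have h₁ := LooplessQuiver.form_eq M N hM hN
  have h₂ := LooplessQuiver.form_eq N M hN hM
  rw [LooplessQuiver.form_comm] at h₂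
  exact ⟨h₁, by omega⟩

end GreenSeqPaper
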